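/- Let k be an integer with k < 0 and let a^o(n,k) denote the number of compositions in A(n,k) having an odd number of parts. Then for every integer n ≥ 1, a^o(n,k) = a(n−1,k), with the convention a(0,k) = 1. -/

import Mathlib

/-- A composition of `n`: a list of positive integers summing to `n`. -/
def IsComposition (n : ℤ) (l : List ℕ) : Prop :=
  (∀ x ∈ l, 0 < x) ∧ (l.sum : ℤ) = n

/-- Generalized Arndt condition with integer shift `k`:
`c_{2i-1} > c_{2i} + k` for every pair of consecutive parts. -/
def ArndtCondK (k : ℤ) (l : List ℕ) : Prop :=
  ∀ i : ℕ, 2 * i + 1 < l.length →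
    (l.getD (2 * i + 1) 0 : ℤ) + k < (l.getD (2 * i) 0 : ℤ)

theorem arndtCondK_of_length_le_one {k : ℤ} {l : List ℕ} (h : l.length ≤ 1) :
    ArndtCondK k l := by
  intro i hi
  omega

theorem arndtCondK_cons_cons {k : ℤ} {a b : ℕ} {l : List ℕ} :
    ArndtCondK k (a :: b :: l) ↔ (b : ℤ) + k < a ∧ ArndtCondK k l := by
  constructor
  · intro h
    refine ⟨by simpa using h 0 (by simp), fun i hi => ?_⟩
    simpa [Nat.mul_add] using h (i + 1) (by simp only [List.length_cons]; omega)
  · rintro ⟨h0, h⟩ i hi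
    cases i with
    | zero => simpa using h0
    | succ i =>
      simpa [Nat.mul_add] using h i (by simp only [List.length_cons] at hi; omega)

/-- Append a part `1` to a list of even length, and add `1` to the last part of a list of
odd length. -/
def oddExtend : List ℕ → List ℕ
  | [] => [1]
  | [a] => [a + 1]
  | a :: b :: l => a :: b :: oddExtend l

theorem odd_length_oddExtend (l : List ℕ) : Odd (oddExtend l).length := by
  fun_induction oddExtend l with
  | case1 => simp
  | case2 => simp
  | case3 a b l ih => simp only [List.length_cons]; grind

theorem sum_oddExtend (l : List ℕ) : (oddExtend l).sum = l.sum + 1 := by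
  fun_induction oddExtend l with
  | case1 => simp
  | case2 => simp
  | case3 a b l ih => simp only [List.sum_cons, ih]; ring

theorem arndtCondK_oddExtend {k : ℤ} (l : List ℕ) :
    ArndtCondK k (oddExtend l) ↔ ArndtCondK k l := by
  fun_induction oddExtend l with
  | case1 => simp [arndtCondK_of_length_le_one]
  | case2 => simp [arndtCondK_of_length_le_one]
  | case3 a b l ih => simp [arndtCondK_cons_cons, ih]

theorem pos_of_mem_oddExtend (l : List ℕ) (h : ∀ x ∈ l, 0 < x) :
    ∀ x ∈ oddExtend l, 0 < x := by
  fun_induction oddExtend l with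
  | case1 => simp
  | case2 => simp
  | case3 a b l ih => simp_all

theorem oddExtend_injOn : Set.InjOn oddExtend {l | ∀ x ∈ l, 0 < x} := by
  intro l hl m hm h
  induction l using oddExtend.induct generalizing m with
  | case1 => rcases m with _ | ⟨c, _ | ⟨d, m⟩⟩ <;> simp_all [oddExtend]
  | case2 a => rcases m with _ | ⟨c, _ | ⟨d, m⟩⟩ <;> simp_all [oddExtend]
  | case3 a b l ih =>
    rcases m with _ | ⟨c, _ | ⟨d, m⟩⟩
    · simp [oddExtend] at h
    · simp [oddExtend] at h
    · simp only [oddExtend, List.cons.injEq] at h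
      simp only [Set.mem_ofPred_eq, List.forall_mem_cons] at hl hm
      rw [h.1, h.2.1, ih hl.2.2 hm.2.2 h.2.2]

theorem exists_oddExtend_eq (l : List ℕ) (hl : ∀ x ∈ l, 0 < x) (ho : Odd l.length) :
    ∃ m, (∀ x ∈ m, 0 < x) ∧ oddExtend m = l := by
  induction l using oddExtend.induct with
  | case1 => simp at ho
  | case2 a =>
    simp only [List.forall_mem_singleton] at hl
    by_cases ha : a = 1
    · exact ⟨[], by simp, by simp [oddExtend, ha]⟩
    · exact ⟨[a - 1], by simp; omega, by simp [oddExtend]; omega⟩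
  | case3 a b l ih =>
    simp only [List.forall_mem_cons] at hl
    obtain ⟨m, hm, rfl⟩ := ih hl.2.2 (by simp only [List.length_cons] at ho; grind)
    exact ⟨a :: b :: m, by simpa using ⟨hl.1, hl.2.1, hm⟩, rfl⟩

theorem card_odd_length_eq_card (k n : ℤ) :
    Nat.card {l : List ℕ // IsComposition n l ∧ ArndtCondK k l ∧ Odd l.length} =
      Nat.card {l : List ℕ // IsComposition (n - 1) l ∧ ArndtCondK k l} := by
  symm
  refine Nat.card_eq_of_bijective (fun l => ⟨oddExtend l.1,
    ⟨pos_of_mem_oddExtend _ l.2.1.1, ?_⟩, (arndtCondK_oddExtend _).2 l.2.2,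
    odd_length_oddExtend _⟩) ⟨?_, ?_⟩
  · have := l.2.1.2
    rw [sum_oddExtend, Nat.cast_add_one]
    omega
  · intro l m h
    exact Subtype.ext (oddExtend_injOn l.2.1.1 m.2.1.1 (congrArg Subtype.val h))
  · rintro ⟨l, ⟨hpos, hsum⟩, hk, ho⟩
    obtain ⟨m, hm, rfl⟩ := exists_oddExtend_eq l hpos ho
    refine ⟨⟨m, ⟨hm, ?_⟩, (arndtCondK_oddExtend m).1 hk⟩, rfl⟩
    rw [sum_oddExtend, Nat.cast_add_one] at hsum
    omega

theorem card_isComposition_zero (k : ℤ) :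
    Nat.card {l : List ℕ // IsComposition 0 l ∧ ArndtCondK k l} = 1 := by
  rw [Nat.card_eq_one_iff_unique]
  refine ⟨⟨?_⟩, ⟨[], by simp [IsComposition], arndtCondK_of_length_le_one (by simp)⟩⟩
  have eq_nil : ∀ l : List ℕ, IsComposition 0 l → l = [] := by
    rintro l ⟨hpos, hsum⟩
    refine List.eq_nil_iff_forall_not_mem.2 fun x hx => ?_
    have := List.le_sum_of_mem hx
    have := hpos x hx
    omega
  rintro ⟨l, hl, -⟩ ⟨m, hm, -⟩
  simp [eq_nil l hl, eq_nil m hm]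

/-- For `k < 0`, the number of compositions in `A(n,k)` with an odd number of
parts equals `a(n-1,k)`. -/
theorem arndt_odd_length_count (k : ℤ) (hk : k < 0) (a : ℤ → ℕ)
    (ha0 : a 0 = 1) (haneg : ∀ m : ℤ, m < 0 → a m = 0)
    (hapos : ∀ m : ℤ, 0 < m →
      a m = Nat.card {l : List ℕ // IsComposition m l ∧ ArndtCondK k l}) :
    ∀ n : ℤ, 1 ≤ n →
      Nat.card {l : List ℕ // IsComposition n l ∧ ArndtCondK k l ∧ Odd l.length} =
        a (n - 1) := by
  intro n hn
  rw [card_odd_length_eq_card]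
  rcases hn.eq_or_lt with rfl | h
  · rw [sub_self, ha0, card_isComposition_zero]
  · rw [hapos (n - 1) (by omega)]
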